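/- arXiv:1605.02078 — 2 statements merged into one kernel-verified Lean document; each statement's English description precedes it below -/
import Mathlib

section
/- For any four random variables X1, X2, X3, X4 (each taking finitely many values, defined on a common probability space), the Zhang–Yeung non-Shannon inequality holds: 2·I(X1:X2|X3) + I(X1:X2|X4) + I(X3:X4) − I(X1:X2) + I(X1:X3|X2) + I(X2:X3|X1) ≥ 0. -/
open Finset
open scoped Classical

/-- Probability that the random variable `X` (on the finite weighted sample space
`(Ω, μ)`) takes the value `b`. -/
noncomputable def pr {Ω β : Type*} [Fintype Ω] (μ : Ω → ℝ) (X : Ω → β) (b : β) : ℝ :=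
  ∑ ω, if X ω = b then μ ω else 0

/-- Shannon entropy of the random variable `X` on the finite weighted sample space
`(Ω, μ)`. -/
noncomputable def ent {Ω β : Type*} [Fintype Ω] [Fintype β] (μ : Ω → ℝ) (X : Ω → β) : ℝ :=
  ∑ b, Real.negMulLog (pr μ X b)

/-- Mutual information `I(X : Y)`. -/
noncomputable def mi {Ω β γ : Type*} [Fintype Ω] [Fintype β] [Fintype γ]
    (μ : Ω → ℝ) (X : Ω → β) (Y : Ω → γ) : ℝ :=
  ent μ X + ent μ Y - ent μ (fun ω => (X ω, Y ω))

/-- Conditional mutual information `I(X : Y | Z)`. -/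
noncomputable def cmi {Ω β γ δ : Type*} [Fintype Ω] [Fintype β] [Fintype γ] [Fintype δ]
    (μ : Ω → ℝ) (X : Ω → β) (Y : Ω → γ) (Z : Ω → δ) : ℝ :=
  ent μ (fun ω => (X ω, Z ω)) + ent μ (fun ω => (Y ω, Z ω)) - ent μ Z
    - ent μ (fun ω => (X ω, Y ω, Z ω))

/-- The Ingleton quantity `I_ING(S,T;U,V)`. -/
noncomputable def ing {Ω β γ δ ε : Type*} [Fintype Ω] [Fintype β] [Fintype γ] [Fintype δ]
    [Fintype ε] (μ : Ω → ℝ) (S : Ω → β) (T : Ω → γ) (U : Ω → δ) (V : Ω → ε) : ℝ :=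
  cmi μ S T U + cmi μ S T V + mi μ U V - mi μ S T

section Entropy

variable {Ω Ω' β γ δ : Type*} [Fintype Ω] [Fintype Ω']

/-- The mean of `f X` computed from the law of `X`. -/
lemma sum_pr_mul [Fintype β] (μ : Ω → ℝ) (X : Ω → β) (f : β → ℝ) :
    ∑ b, pr μ X b * f b = ∑ ω, μ ω * f (X ω) := by
  simp only [pr, sum_mul, ite_mul, zero_mul]
  rw [sum_comm]
  simp

lemma pr_nonneg {μ : Ω → ℝ} (hμ : ∀ ω, 0 ≤ μ ω) (X : Ω → β) (b : β) : 0 ≤ pr μ X b :=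
  sum_nonneg fun ω _ => by split_ifs <;> simp [hμ]

lemma le_pr {μ : Ω → ℝ} (hμ : ∀ ω, 0 ≤ μ ω) (X : Ω → β) (ω : Ω) : μ ω ≤ pr μ X (X ω) := by
  have h := single_le_sum (f := fun ω' => if X ω' = X ω then μ ω' else 0)
    (fun ω' _ => by split_ifs <;> simp [hμ]) (mem_univ ω)
  simpa [pr] using h

/-- Entropy as the mean of the information content. -/
lemma ent_eq_sum [Fintype β] (μ : Ω → ℝ) (X : Ω → β) :
    ent μ X = -∑ ω, μ ω * Real.log (pr μ X (X ω)) := by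
  rw [← sum_pr_mul μ X fun b => Real.log (pr μ X b)]
  simp [ent, Real.negMulLog]

/-- Variables inducing the same partition of the support have the same entropy. -/
lemma ent_congr [Fintype β] [Fintype γ] {μ : Ω → ℝ} {X : Ω → β} {Y : Ω → γ}
    (h : ∀ ω ω', μ ω ≠ 0 → μ ω' ≠ 0 → (X ω = X ω' ↔ Y ω = Y ω')) : ent μ X = ent μ Y := by
  simp only [ent_eq_sum, pr]
  congr 1
  refine sum_congr rfl fun ω _ => ?_
  by_cases hω : μ ω = 0
  · simp [hω]
  · congr 2
    refine sum_congr rfl fun ω' _ => ?_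
    by_cases hω' : μ ω' = 0
    · simp [hω']
    · simp only [h ω' ω hω' hω]

lemma pr_comp {μ : Ω → ℝ} {ν : Ω' → ℝ} {g : Ω' → Ω} (hg : ∀ ω, pr ν g ω = μ ω)
    (X : Ω → β) (b : β) : pr ν (fun ω' => X (g ω')) b = pr μ X b := by
  have h := sum_pr_mul ν g fun ω => if X ω = b then 1 else 0
  simp only [hg, mul_ite, mul_one, mul_zero] at h
  exact h.symm

/-- If `g` carries `ν` to `μ`, variables that are `ν`-almost surely pulled back along `g` keep
their entropy. -/
lemma ent_comp [Fintype β] {μ : Ω → ℝ} {ν : Ω' → ℝ} {g : Ω' → Ω} (hg : ∀ ω, pr ν g ω = μ ω)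
    {X : Ω → β} {X' : Ω' → β} (hX : ∀ ω', ν ω' ≠ 0 → X' ω' = X (g ω')) : ent ν X' = ent μ X := by
  rw [ent_congr (Y := fun ω' => X (g ω')) fun p q hp hq => by rw [hX p hp, hX q hq]]
  simp only [ent, pr_comp hg]

lemma mi_comp [Fintype β] [Fintype γ] {μ : Ω → ℝ} {ν : Ω' → ℝ} {g : Ω' → Ω}
    (hg : ∀ ω, pr ν g ω = μ ω) {X : Ω → β} {X' : Ω' → β} {Y : Ω → γ} {Y' : Ω' → γ}
    (hX : ∀ ω', ν ω' ≠ 0 → X' ω' = X (g ω')) (hY : ∀ ω', ν ω' ≠ 0 → Y' ω' = Y (g ω')) :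
    mi ν X' Y' = mi μ X Y := by
  rw [mi, mi, ent_comp hg hX, ent_comp hg hY,
    ent_comp hg (X := fun ω => (X ω, Y ω)) fun p hp => by rw [hX p hp, hY p hp]]

lemma cmi_comp [Fintype β] [Fintype γ] [Fintype δ] {μ : Ω → ℝ} {ν : Ω' → ℝ} {g : Ω' → Ω}
    (hg : ∀ ω, pr ν g ω = μ ω) {X : Ω → β} {X' : Ω' → β} {Y : Ω → γ} {Y' : Ω' → γ}
    {Z : Ω → δ} {Z' : Ω' → δ} (hX : ∀ ω', ν ω' ≠ 0 → X' ω' = X (g ω'))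
    (hY : ∀ ω', ν ω' ≠ 0 → Y' ω' = Y (g ω')) (hZ : ∀ ω', ν ω' ≠ 0 → Z' ω' = Z (g ω')) :
    cmi ν X' Y' Z' = cmi μ X Y Z := by
  rw [cmi, cmi, ent_comp hg hZ,
    ent_comp hg (X := fun ω => (X ω, Z ω)) fun p hp => by rw [hX p hp, hZ p hp],
    ent_comp hg (X := fun ω => (Y ω, Z ω)) fun p hp => by rw [hY p hp, hZ p hp],
    ent_comp hg (X := fun ω => (X ω, Y ω, Z ω)) fun p hp => by rw [hX p hp, hY p hp, hZ p hp]]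

lemma sum_pr_pair [Fintype β] (μ : Ω → ℝ) (X : Ω → β) (Z : Ω → δ) (z : δ) :
    ∑ x, pr μ (fun ω => (X ω, Z ω)) (x, z) = pr μ Z z := by
  simp only [pr, Prod.mk.injEq, ite_and]
  rw [sum_comm]
  simp

lemma sum_mul_pr_div_le [Fintype β] [Fintype γ] [Fintype δ] {μ : Ω → ℝ} (hμ : ∀ ω, 0 ≤ μ ω)
    (X : Ω → β) (Y : Ω → γ) (Z : Ω → δ) :
    ∑ ω, μ ω * (pr μ (fun ω => (X ω, Z ω)) (X ω, Z ω) * pr μ (fun ω => (Y ω, Z ω)) (Y ω, Z ω)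
      / (pr μ (fun ω => (X ω, Y ω, Z ω)) (X ω, Y ω, Z ω) * pr μ Z (Z ω))) ≤ ∑ ω, μ ω := by
  rw [← sum_pr_mul μ (fun ω => (X ω, Y ω, Z ω)) fun b =>
    pr μ (fun ω => (X ω, Z ω)) (b.1, b.2.2) * pr μ (fun ω => (Y ω, Z ω)) b.2
      / (pr μ (fun ω => (X ω, Y ω, Z ω)) b * pr μ Z b.2.2)]
  calc _ ≤ ∑ b : β × γ × δ, pr μ (fun ω => (X ω, Z ω)) (b.1, b.2.2)
            * pr μ (fun ω => (Y ω, Z ω)) b.2 / pr μ Z b.2.2 := by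
        refine sum_le_sum fun b _ => ?_
        have hX := pr_nonneg hμ (fun ω => (X ω, Z ω)) (b.1, b.2.2)
        have hY := pr_nonneg hμ (fun ω => (Y ω, Z ω)) b.2
        have hZ := pr_nonneg hμ Z b.2.2
        by_cases h : pr μ (fun ω => (X ω, Y ω, Z ω)) b = 0
        · rw [h, zero_mul]
          positivity
        · rw [← mul_div_assoc, mul_div_mul_left _ _ h]
    _ = ∑ z, pr μ Z z := by
        rw [Fintype.sum_prod_type_right, Fintype.sum_prod_type_right]
        refine sum_congr rfl fun z _ => ?_
        simp only [← sum_div, ← sum_mul, ← mul_sum, sum_pr_pair]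
        exact mul_self_div_self _
    _ = ∑ ω, μ ω := by simpa using sum_pr_mul μ Z fun _ => 1

/-- Conditional mutual information is nonnegative. -/
lemma cmi_nonneg [Fintype β] [Fintype γ] [Fintype δ] {μ : Ω → ℝ} (hμ : ∀ ω, 0 ≤ μ ω)
    (X : Ω → β) (Y : Ω → γ) (Z : Ω → δ) : 0 ≤ cmi μ X Y Z := by
  have key : -cmi μ X Y Z ≤ ∑ ω, (μ ω * (pr μ (fun ω => (X ω, Z ω)) (X ω, Z ω)
      * pr μ (fun ω => (Y ω, Z ω)) (Y ω, Z ω)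
      / (pr μ (fun ω => (X ω, Y ω, Z ω)) (X ω, Y ω, Z ω) * pr μ Z (Z ω))) - μ ω) := by
    have hcmi : -cmi μ X Y Z = ∑ ω, μ ω * (Real.log (pr μ (fun ω => (X ω, Z ω)) (X ω, Z ω))
        + Real.log (pr μ (fun ω => (Y ω, Z ω)) (Y ω, Z ω)) - Real.log (pr μ Z (Z ω))
        - Real.log (pr μ (fun ω => (X ω, Y ω, Z ω)) (X ω, Y ω, Z ω))) := by
      simp only [cmi, ent_eq_sum, mul_sub, mul_add, sum_sub_distrib, sum_add_distrib]
      ring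
    rw [hcmi]
    refine sum_le_sum fun ω _ => ?_
    rcases (hμ ω).eq_or_lt with h | h
    · simp [← h]
    have hXZ := h.trans_le (le_pr hμ (fun ω => (X ω, Z ω)) ω)
    have hYZ := h.trans_le (le_pr hμ (fun ω => (Y ω, Z ω)) ω)
    have hZ := h.trans_le (le_pr hμ Z ω)
    have hXYZ := h.trans_le (le_pr hμ (fun ω => (X ω, Y ω, Z ω)) ω)
    have hlog := Real.log_le_sub_one_of_pos (div_pos (mul_pos hXZ hYZ) (mul_pos hXYZ hZ))
    rw [Real.log_div (mul_pos hXZ hYZ).ne' (mul_pos hXYZ hZ).ne',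
      Real.log_mul hXZ.ne' hYZ.ne', Real.log_mul hXYZ.ne' hZ.ne'] at hlog
    have := mul_le_mul_of_nonneg_left hlog h.le
    linarith
  rw [sum_sub_distrib] at key
  linarith [sum_mul_pr_div_le hμ X Y Z]

/-- Submodularity of entropy, for variables given up to relabelling of their values. -/
lemma ent_submodular {α₁ α₂ α₃ α₄ : Type*} [Fintype α₁] [Fintype α₂] [Fintype α₃] [Fintype α₄]
    {μ : Ω → ℝ} (hμ : ∀ ω, 0 ≤ μ ω) (P : Ω → α₁) (Q : Ω → α₂) (M : Ω → α₃) (J : Ω → α₄)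
    (hJ : ∀ ω ω', J ω = J ω' ↔ P ω = P ω' ∧ Q ω = Q ω')
    (hP : ∀ ω ω', P ω = P ω' → M ω = M ω') (hQ : ∀ ω ω', Q ω = Q ω' → M ω = M ω') :
    ent μ M + ent μ J ≤ ent μ P + ent μ Q := by
  have h := cmi_nonneg hμ P Q M
  rw [cmi, ent_congr (Y := P) (by grind), ent_congr (X := fun ω => (Q ω, M ω)) (Y := Q) (by grind),
    ent_congr (X := fun ω => (P ω, Q ω, M ω)) (Y := J) (by grind)] at h
  linarith

/-- A five-variable Shannon inequality: an auxiliary variable `R` that is nearly independent of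
`(C, D)` given `(A, B)` bounds the violation of Ingleton's inequality. -/
lemma ing_add_nonneg {α₁ α₂ α₃ α₄ α₅ : Type*} [Fintype α₁] [Fintype α₂] [Fintype α₃] [Fintype α₄]
    [Fintype α₅] {μ : Ω → ℝ} (hμ : ∀ ω, 0 ≤ μ ω)
    (A : Ω → α₁) (B : Ω → α₂) (C : Ω → α₃) (D : Ω → α₄) (R : Ω → α₅) :
    0 ≤ ing μ A B C D + cmi μ A B R + cmi μ A R B + cmi μ B R A
      + 3 * cmi μ R (fun ω => (C ω, D ω)) (fun ω => (A ω, B ω)) := by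
  have hBR : ent μ (fun ω => (R ω, B ω)) = ent μ fun ω => (B ω, R ω) := ent_congr (by grind)
  have hAR : ent μ (fun ω => (R ω, A ω)) = ent μ fun ω => (A ω, R ω) := ent_congr (by grind)
  have hBA : ent μ (fun ω => (B ω, A ω)) = ent μ fun ω => (A ω, B ω) := ent_congr (by grind)
  have hARB : ent μ (fun ω => (A ω, R ω, B ω)) = ent μ fun ω => (A ω, B ω, R ω) :=
    ent_congr (by grind)
  have hBRA : ent μ (fun ω => (B ω, R ω, A ω)) = ent μ fun ω => (A ω, B ω, R ω) :=
    ent_congr (by grind)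
  have hRAB : ent μ (fun ω => (R ω, A ω, B ω)) = ent μ fun ω => (A ω, B ω, R ω) :=
    ent_congr (by grind)
  -- `I(C:D|R) ≥ 0`
  have hCD_R := ent_submodular hμ (fun ω => (C ω, R ω)) (fun ω => (D ω, R ω)) R
    (fun ω => (C ω, D ω, R ω)) (by grind) (by grind) (by grind)
  -- `I(R:AB|CD) ≥ 0`
  have hRAB_CD := ent_submodular hμ (fun ω => (C ω, D ω, R ω))
    (fun ω => ((C ω, D ω), A ω, B ω)) (fun ω => (C ω, D ω))
    (fun ω => (R ω, (C ω, D ω), A ω, B ω)) (by grind) (by grind) (by grind)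
  -- `I(A:B|RC) ≥ 0` and `I(A:B|RD) ≥ 0`
  have hAB_RC := ent_submodular hμ (fun ω => (A ω, C ω, R ω)) (fun ω => (B ω, C ω, R ω))
    (fun ω => (C ω, R ω)) (fun ω => (A ω, B ω, C ω, R ω)) (by grind) (by grind) (by grind)
  have hAB_RD := ent_submodular hμ (fun ω => (A ω, D ω, R ω)) (fun ω => (B ω, D ω, R ω))
    (fun ω => (D ω, R ω)) (fun ω => (A ω, B ω, D ω, R ω)) (by grind) (by grind) (by grind)
  -- `I(R:C|A)`, `I(R:C|B)`, `I(R:D|A)` and `I(R:D|B)` are nonnegative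
  have hRC_A := ent_submodular hμ (fun ω => (A ω, R ω)) (fun ω => (A ω, C ω)) A
    (fun ω => (A ω, C ω, R ω)) (by grind) (by grind) (by grind)
  have hRC_B := ent_submodular hμ (fun ω => (B ω, R ω)) (fun ω => (B ω, C ω)) B
    (fun ω => (B ω, C ω, R ω)) (by grind) (by grind) (by grind)
  have hRD_A := ent_submodular hμ (fun ω => (A ω, R ω)) (fun ω => (A ω, D ω)) A
    (fun ω => (A ω, D ω, R ω)) (by grind) (by grind) (by grind)
  have hRD_B := ent_submodular hμ (fun ω => (B ω, R ω)) (fun ω => (B ω, D ω)) B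
    (fun ω => (B ω, D ω, R ω)) (by grind) (by grind) (by grind)
  -- `I(R:D|ABC) ≥ 0` and `I(R:C|ABD) ≥ 0`
  have hRD_ABC := ent_submodular hμ (fun ω => (A ω, B ω, C ω, R ω))
    (fun ω => ((C ω, D ω), A ω, B ω)) (fun ω => (A ω, B ω, C ω))
    (fun ω => (R ω, (C ω, D ω), A ω, B ω)) (by grind) (by grind) (by grind)
  have hRC_ABD := ent_submodular hμ (fun ω => (A ω, B ω, D ω, R ω))
    (fun ω => ((C ω, D ω), A ω, B ω)) (fun ω => (A ω, B ω, D ω))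
    (fun ω => (R ω, (C ω, D ω), A ω, B ω)) (by grind) (by grind) (by grind)
  simp only [ing, cmi, mi]
  linarith

/-- The law of two samples from `μ` that share the value of `Z` and are otherwise independent. -/
noncomputable def condCoupling (μ : Ω → ℝ) (Z : Ω → δ) (p : Ω × Ω) : ℝ :=
  if Z p.1 = Z p.2 then μ p.1 * μ p.2 / pr μ Z (Z p.1) else 0

lemma condCoupling_nonneg {μ : Ω → ℝ} (hμ : ∀ ω, 0 ≤ μ ω) (Z : Ω → δ) (p : Ω × Ω) :
    0 ≤ condCoupling μ Z p := by
  unfold condCoupling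
  split_ifs
  · exact div_nonneg (mul_nonneg (hμ _) (hμ _)) (pr_nonneg hμ _ _)
  · exact le_rfl

lemma eq_of_condCoupling_ne_zero {μ : Ω → ℝ} {Z : Ω → δ} {p : Ω × Ω}
    (hp : condCoupling μ Z p ≠ 0) : Z p.1 = Z p.2 := by
  by_contra h
  exact hp (if_neg h)

lemma condCoupling_swap (μ : Ω → ℝ) (Z : Ω → δ) (ω ω' : Ω) :
    condCoupling μ Z (ω, ω') = condCoupling μ Z (ω', ω) := by
  unfold condCoupling
  by_cases h : Z ω = Z ω'
  · simp [h, mul_comm]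
  · simp [h, Ne.symm h]

lemma div_pr_mul_pr_self {μ : Ω → ℝ} (hμ : ∀ ω, 0 ≤ μ ω) (Z : Ω → δ) (ω : Ω) :
    μ ω / pr μ Z (Z ω) * pr μ Z (Z ω) = μ ω :=
  div_mul_cancel_of_imp fun h => le_antisymm (h ▸ le_pr hμ Z ω) (hμ ω)

lemma sum_condCoupling {μ : Ω → ℝ} (hμ : ∀ ω, 0 ≤ μ ω) (Z : Ω → δ) (ω : Ω) :
    ∑ ω', condCoupling μ Z (ω, ω') = μ ω := by
  conv_rhs => rw [← div_pr_mul_pr_self hμ Z ω]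
  conv_rhs => enter [2]; rw [pr]
  rw [mul_sum]
  refine sum_congr rfl fun ω' _ => ?_
  simp only [condCoupling, mul_ite, mul_zero, eq_comm (a := Z ω')]
  split_ifs <;> ring

lemma pr_condCoupling_fst {μ : Ω → ℝ} (hμ : ∀ ω, 0 ≤ μ ω) (Z : Ω → δ) (ω : Ω) :
    pr (condCoupling μ Z) Prod.fst ω = μ ω := by
  rw [pr, Fintype.sum_prod_type_right]
  simp [sum_condCoupling hμ]

lemma pr_condCoupling_snd {μ : Ω → ℝ} (hμ : ∀ ω, 0 ≤ μ ω) (Z : Ω → δ) (ω : Ω) :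
    pr (condCoupling μ Z) Prod.snd ω = μ ω := by
  rw [pr, Fintype.sum_prod_type]
  simp [condCoupling_swap μ Z _ ω, sum_condCoupling hμ]

lemma pr_condCoupling_mul_pr {μ : Ω → ℝ} (hμ : ∀ ω, 0 ≤ μ ω) (R : Ω → β) (Y : Ω → γ) (Z : Ω → δ)
    (r : β) (y : γ) (z : δ) :
    pr (condCoupling μ Z) (fun p => (R p.2, Y p.1, Z p.1)) (r, y, z) * pr μ Z z
      = pr μ (fun ω => (R ω, Z ω)) (r, z) * pr μ (fun ω => (Y ω, Z ω)) (y, z) := by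
  conv_rhs => rw [pr, pr, sum_mul_sum]
  rw [pr, sum_mul, Fintype.sum_prod_type_right]
  refine sum_congr rfl fun ω' _ => sum_congr rfl fun ω _ => ?_
  by_cases hz : Z ω = z
  · subst hz
    have h := div_pr_mul_pr_self hμ Z ω
    by_cases hZ : Z ω = Z ω'
    · by_cases hr : R ω' = r <;> by_cases hy : Y ω = y <;> simp [hr, hy, ← hZ, condCoupling]
      linear_combination μ ω' * h
    · simp [hZ, Ne.symm hZ, condCoupling]
  · simp [hz]

/-- In the conditional coupling the two samples are conditionally independent given `Z`. -/
lemma cmi_condCoupling [Fintype β] [Fintype γ] [Fintype δ] {μ : Ω → ℝ} (hμ : ∀ ω, 0 ≤ μ ω)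
    (R : Ω → β) (Y : Ω → γ) (Z : Ω → δ) :
    cmi (condCoupling μ Z) (fun p => R p.2) (fun p => Y p.1) (fun p => Z p.1) = 0 := by
  have hν := condCoupling_nonneg hμ Z
  have hRZ : ent (condCoupling μ Z) (fun p => (R p.2, Z p.1))
      = ent (condCoupling μ Z) fun p => (R p.2, Z p.2) :=
    ent_congr fun p q hp hq => by
      rw [eq_of_condCoupling_ne_zero hp, eq_of_condCoupling_ne_zero hq]
  have hsum : ∑ p, condCoupling μ Z p * (Real.log (pr (condCoupling μ Z)
        (fun p => (R p.2, Y p.1, Z p.1)) (R p.2, Y p.1, Z p.1)) + Real.log (pr μ Z (Z p.1))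
      - Real.log (pr μ (fun ω => (R ω, Z ω)) (R p.2, Z p.2))
      - Real.log (pr μ (fun ω => (Y ω, Z ω)) (Y p.1, Z p.1))) = 0 := by
    refine sum_eq_zero fun p _ => ?_
    by_cases hp : condCoupling μ Z p = 0
    · simp [hp]
    have hpos := (hν p).lt_of_ne' hp
    have hJ := hpos.trans_le (le_pr hν (fun p => (R p.2, Y p.1, Z p.1)) p)
    have hZ := hpos.trans_le (le_pr hν (fun p => Z p.1) p)
    have hR := hpos.trans_le (le_pr hν (fun p => (R p.2, Z p.2)) p)
    have hY := hpos.trans_le (le_pr hν (fun p => (Y p.1, Z p.1)) p)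
    rw [pr_comp (pr_condCoupling_fst hμ Z)] at hZ
    rw [pr_comp (pr_condCoupling_fst hμ Z) fun ω => (Y ω, Z ω)] at hY
    rw [pr_comp (pr_condCoupling_snd hμ Z) fun ω => (R ω, Z ω)] at hR
    have h := congrArg Real.log (pr_condCoupling_mul_pr hμ R Y Z (R p.2) (Y p.1) (Z p.1))
    rw [eq_of_condCoupling_ne_zero hp] at *
    rw [Real.log_mul hJ.ne' hZ.ne', Real.log_mul hR.ne' hY.ne'] at h
    rw [h]
    ring
  simp only [mul_sub, mul_add, sum_sub_distrib, sum_add_distrib] at hsum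
  rw [cmi, hRZ]
  simp only [ent_eq_sum, pr_comp (pr_condCoupling_fst hμ Z) Z,
    pr_comp (pr_condCoupling_fst hμ Z) fun ω => (Y ω, Z ω),
    pr_comp (pr_condCoupling_snd hμ Z) fun ω => (R ω, Z ω)]
  linarith

end Entropy

/-- **Zhang–Yeung non-Shannon inequality.** For any four random variables
`X1, X2, X3, X4` on a common finite probability space,
`2·I(X1:X2|X3) + I(X1:X2|X4) + I(X3:X4) − I(X1:X2) + I(X1:X3|X2) + I(X2:X3|X1) ≥ 0`. -/
theorem zhang_yeung {Ω β₁ β₂ β₃ β₄ : Type*} [Fintype Ω]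
    [Fintype β₁] [Fintype β₂] [Fintype β₃] [Fintype β₄]
    (μ : Ω → ℝ) (hμ0 : ∀ ω, 0 ≤ μ ω) (hμ1 : ∑ ω, μ ω = 1)
    (X1 : Ω → β₁) (X2 : Ω → β₂) (X3 : Ω → β₃) (X4 : Ω → β₄) :
    0 ≤ 2 * cmi μ X1 X2 X3 + cmi μ X1 X2 X4 + mi μ X3 X4 - mi μ X1 X2
      + cmi μ X1 X3 X2 + cmi μ X2 X3 X1 := by
  let A := fun p : Ω × Ω => X1 p.1
  let B := fun p : Ω × Ω => X2 p.1
  let C := fun p : Ω × Ω => X3 p.1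
  let D := fun p : Ω × Ω => X4 p.1
  let R := fun p : Ω × Ω => X3 p.2
  let Z := fun ω => (X1 ω, X2 ω)
  let ν := condCoupling μ Z
  have hA : ∀ p, ν p ≠ 0 → A p = X1 p.2 := fun p hp =>
    (Prod.ext_iff.mp (eq_of_condCoupling_ne_zero hp)).1
  have hB : ∀ p, ν p ≠ 0 → B p = X2 p.2 := fun p hp =>
    (Prod.ext_iff.mp (eq_of_condCoupling_ne_zero hp)).2
  have hR : ∀ p, ν p ≠ 0 → R p = X3 p.2 := fun _ _ => rfl
  have hfst := pr_condCoupling_fst hμ0 Z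
  have hsnd := pr_condCoupling_snd hμ0 Z
  have hing : ing ν A B C D = ing μ X1 X2 X3 X4 := by
    rw [ing, ing, cmi_comp hfst (X := X1) (Y := X2) (Z := X3), cmi_comp hfst (X := X1) (Y := X2)
      (Z := X4), mi_comp hfst (X := X3) (Y := X4), mi_comp hfst (X := X1) (Y := X2)] <;>
    exact fun _ _ => rfl
  have h := ing_add_nonneg (condCoupling_nonneg hμ0 Z) A B C D R
  have hind := cmi_condCoupling hμ0 X3 (fun ω => (X3 ω, X4 ω)) Z
  change 0 ≤ ing ν A B C D + cmi ν A B R + cmi ν A R B + cmi ν B R A + 3 * cmi ν _ _ _ at h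
  rw [hing, cmi_comp hsnd hA hB hR, cmi_comp hsnd hA hR hB, cmi_comp hsnd hB hR hA, hind, ing] at h
  linarith
end

section
/- For any four random variables X1, X2, X3, X4 and every integer s ≥ 1, the second Matúš family inequality holds: s·[I(X1:X2|X3) + I(X1:X2|X4) + I(X3:X4) − I(X1:X2)] + s·[I(X2:X3|X1) + I(X1:X2|X3)] + I(X1:X3|X2) + (s(s−1)/2)·[I(X2:X4|X1) + I(X1:X2|X4)] ≥ 0. -/
open Finset
open scoped Classical

/-- The `μ`-mass of the class of `ω` under the equivalence relation `r`. -/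
noncomputable def classMass {Ω : Type*} [Fintype Ω] (μ : Ω → ℝ) (r : Setoid Ω) (ω : Ω) : ℝ :=
  ∑ ω', if r ω ω' then μ ω' else 0

/-- Shannon entropy of the partition of `(Ω, μ)` into classes of `r`. Working with partitions
instead of random variables turns joint variables into infima. -/
noncomputable def partEnt {Ω : Type*} [Fintype Ω] (μ : Ω → ℝ) (r : Setoid Ω) : ℝ :=
  ∑ ω, μ ω * -Real.log (classMass μ r ω)

/-- Mutual information of two partitions. -/
noncomputable def partMI {Ω : Type*} [Fintype Ω] (μ : Ω → ℝ) (r s : Setoid Ω) : ℝ :=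
  partEnt μ r + partEnt μ s - partEnt μ (r ⊓ s)

/-- Conditional mutual information of the partitions `r` and `s` given `t`. -/
noncomputable def partCMI {Ω : Type*} [Fintype Ω] (μ : Ω → ℝ) (r s t : Setoid Ω) : ℝ :=
  partEnt μ (r ⊓ t) + partEnt μ (s ⊓ t) - partEnt μ t - partEnt μ (r ⊓ s ⊓ t)

theorem ker_prodMk {Ω β γ : Type*} (X : Ω → β) (Y : Ω → γ) :
    Setoid.ker (fun ω => (X ω, Y ω)) = Setoid.ker X ⊓ Setoid.ker Y := by
  ext ω ω'
  simp [Setoid.ker_def, Setoid.inf_def]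

theorem comap_inf {Ω Ω' : Type*} (f : Ω' → Ω) (r s : Setoid Ω) :
    Setoid.comap f (r ⊓ s) = Setoid.comap f r ⊓ Setoid.comap f s := rfl

theorem ent_eq_partEnt {Ω β : Type*} [Fintype Ω] [Fintype β] (μ : Ω → ℝ) (X : Ω → β) :
    ent μ X = partEnt μ (Setoid.ker X) := by
  have hmass : ∀ ω, classMass μ (Setoid.ker X) ω = pr μ X (X ω) := fun ω => by
    simp only [classMass, pr, Setoid.ker_def, eq_comm]
  simp only [ent, partEnt, hmass, Real.negMulLog]
  calc ∑ b, -pr μ X b * Real.log (pr μ X b)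
      = ∑ b, ∑ ω, if X ω = b then μ ω * -Real.log (pr μ X b) else 0 := by
        refine sum_congr rfl fun b _ => ?_
        conv_lhs => rw [neg_mul_comm]
        conv_lhs => enter [1]; rw [pr]
        rw [sum_mul]
        simp only [ite_mul, zero_mul]
    _ = _ := by rw [sum_comm]; simp

theorem cmi_eq_partCMI {Ω β γ δ : Type*} [Fintype Ω] [Fintype β] [Fintype γ] [Fintype δ]
    (μ : Ω → ℝ) (X : Ω → β) (Y : Ω → γ) (Z : Ω → δ) :
    cmi μ X Y Z = partCMI μ (Setoid.ker X) (Setoid.ker Y) (Setoid.ker Z) := by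
  simp only [cmi, partCMI, ent_eq_partEnt, ker_prodMk, inf_assoc]

theorem mi_eq_partMI {Ω β γ : Type*} [Fintype Ω] [Fintype β] [Fintype γ]
    (μ : Ω → ℝ) (X : Ω → β) (Y : Ω → γ) :
    mi μ X Y = partMI μ (Setoid.ker X) (Setoid.ker Y) := by
  simp only [mi, partMI, ent_eq_partEnt, ker_prodMk]

section Partition

variable {Ω : Type*} [Fintype Ω] {μ : Ω → ℝ}

theorem classMass_nonneg (hμ : ∀ ω, 0 ≤ μ ω) (r : Setoid Ω) (ω : Ω) : 0 ≤ classMass μ r ω :=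
  sum_nonneg fun ω' _ => by split_ifs <;> simp [hμ]

theorem le_classMass (hμ : ∀ ω, 0 ≤ μ ω) (r : Setoid Ω) (ω : Ω) : μ ω ≤ classMass μ r ω := by
  have h := single_le_sum (f := fun ω' => if r ω ω' then μ ω' else 0)
    (fun ω' _ => by split_ifs <;> simp [hμ]) (mem_univ ω)
  simpa [classMass, r.refl' ω] using h

theorem classMass_congr (μ : Ω → ℝ) {r : Setoid Ω} {ω ω' : Ω} (h : r ω ω') :
    classMass μ r ω = classMass μ r ω' := by
  refine sum_congr rfl fun x _ => ?_
  have : r ω x ↔ r ω' x := ⟨r.trans' (r.symm' h), r.trans' h⟩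
  simp only [this]

/-- The classes of `r ⊓ s` are normalized by their mass. -/
theorem sum_inf_div_classMass_le_one (μ : Ω → ℝ) (r s : Setoid Ω) (x y : Ω) :
    ∑ ω, (if r x ω ∧ s y ω then μ ω / classMass μ (r ⊓ s) ω else 0) ≤ 1 := by
  by_cases h : ∃ z, r x z ∧ s y z
  · obtain ⟨z, hxz, hyz⟩ := h
    have key : ∀ ω, (if r x ω ∧ s y ω then μ ω / classMass μ (r ⊓ s) ω else 0)
        = (if (r ⊓ s) z ω then μ ω else 0) / classMass μ (r ⊓ s) z := by
      intro ω
      have hiff : (r x ω ∧ s y ω) ↔ (r ⊓ s) z ω := by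
        constructor
        · rintro ⟨h1, h2⟩
          exact ⟨r.trans' (r.symm' hxz) h1, s.trans' (s.symm' hyz) h2⟩
        · rintro ⟨h1, h2⟩
          exact ⟨r.trans' hxz h1, s.trans' hyz h2⟩
      by_cases hω : (r ⊓ s) z ω
      · simp only [hiff, hω, if_true, classMass_congr μ hω]
      · simp only [hiff, hω, if_false, zero_div]
    rw [sum_congr rfl fun ω _ => key ω, ← sum_div]
    exact div_self_le_one _
  · push Not at h
    rw [sum_eq_zero]
    · exact zero_le_one
    · intro ω _
      rw [if_neg]
      rintro ⟨h1, h2⟩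
      exact h ω h1 h2

theorem sum_mul_classMass_ratio_le (hμ : ∀ ω, 0 ≤ μ ω) {r s t : Setoid Ω} (hr : r ≤ t)
    (hs : s ≤ t) :
    ∑ ω, μ ω * (classMass μ r ω * classMass μ s ω / (classMass μ (r ⊓ s) ω * classMass μ t ω))
      ≤ ∑ ω, μ ω := by
  calc ∑ ω, μ ω * (classMass μ r ω * classMass μ s ω /
        (classMass μ (r ⊓ s) ω * classMass μ t ω))
      = ∑ ω, ∑ x, ∑ y, (if t x y then μ x * μ y / classMass μ t x else 0) *
          (if r x ω ∧ s y ω then μ ω / classMass μ (r ⊓ s) ω else 0) := by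
        refine sum_congr rfl fun ω _ => ?_
        have expand : μ ω * (classMass μ r ω * classMass μ s ω /
            (classMass μ (r ⊓ s) ω * classMass μ t ω))
            = (∑ x, if r ω x then μ x else 0) * (∑ y, if s ω y then μ y else 0) *
              (μ ω / (classMass μ (r ⊓ s) ω * classMass μ t ω)) := by
          simp only [classMass]; ring
        rw [expand, sum_mul_sum, sum_mul]
        refine sum_congr rfl fun x _ => ?_
        rw [sum_mul]
        refine sum_congr rfl fun y _ => ?_
        by_cases hx : r ω x
        · by_cases hy : s ω y
          · have hxy : t x y := t.trans' (t.symm' (hr hx)) (hs hy)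
            simp only [hx, hy, hxy, r.symm' hx, s.symm' hy, and_self, if_true,
              classMass_congr μ (hr hx)]
            ring
          · have : ¬ s y ω := fun h => hy (s.symm' h)
            simp [hy, this]
        · have : ¬ r x ω := fun h => hx (r.symm' h)
          simp [hx, this]
    _ = ∑ x, ∑ y, (if t x y then μ x * μ y / classMass μ t x else 0) *
          ∑ ω, (if r x ω ∧ s y ω then μ ω / classMass μ (r ⊓ s) ω else 0) := by
        rw [sum_comm]
        refine sum_congr rfl fun x _ => ?_
        rw [sum_comm]
        simp only [mul_sum]
    _ ≤ ∑ x, ∑ y, (if t x y then μ x * μ y / classMass μ t x else 0) := by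
        refine sum_le_sum fun x _ => sum_le_sum fun y _ => ?_
        refine mul_le_of_le_one_right ?_ (sum_inf_div_classMass_le_one μ r s x y)
        split_ifs
        · exact div_nonneg (mul_nonneg (hμ x) (hμ y)) (classMass_nonneg hμ t x)
        · exact le_rfl
    _ = ∑ x, μ x * (classMass μ t x / classMass μ t x) := by
        refine sum_congr rfl fun x _ => ?_
        conv_rhs => enter [2, 1]; rw [classMass]
        rw [sum_div, mul_sum]
        refine sum_congr rfl fun y _ => ?_
        split_ifs
        · ring
        · simp
    _ ≤ ∑ x, μ x := sum_le_sum fun x _ => mul_le_of_le_one_right (hμ x) (div_self_le_one _)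

theorem partEnt_submodular (hμ : ∀ ω, 0 ≤ μ ω) {r s t : Setoid Ω} (hr : r ≤ t) (hs : s ≤ t) :
    partEnt μ t + partEnt μ (r ⊓ s) ≤ partEnt μ r + partEnt μ s := by
  have hterm : ∀ ω, μ ω - μ ω * (classMass μ r ω * classMass μ s ω /
      (classMass μ (r ⊓ s) ω * classMass μ t ω)) ≤
      μ ω * -Real.log (classMass μ r ω) + μ ω * -Real.log (classMass μ s ω)
      - μ ω * -Real.log (classMass μ t ω) - μ ω * -Real.log (classMass μ (r ⊓ s) ω) := by
    intro ω
    rcases (hμ ω).eq_or_lt with h0 | hpos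
    · simp [← h0]
    · have pos : ∀ q : Setoid Ω, 0 < classMass μ q ω := fun q =>
        hpos.trans_le (le_classMass hμ q ω)
      have hlog := Real.log_le_sub_one_of_pos
        (div_pos (mul_pos (pos r) (pos s)) (mul_pos (pos (r ⊓ s)) (pos t)))
      rw [Real.log_div (mul_pos (pos r) (pos s)).ne' (mul_pos (pos (r ⊓ s)) (pos t)).ne',
        Real.log_mul (pos r).ne' (pos s).ne', Real.log_mul (pos (r ⊓ s)).ne' (pos t).ne'] at hlog
      nlinarith [mul_le_mul_of_nonneg_left hlog hpos.le]
  have hsum := sum_le_sum fun ω (_ : ω ∈ univ) => hterm ω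
  simp only [sum_sub_distrib, sum_add_distrib] at hsum
  have := sum_mul_classMass_ratio_le hμ hr hs
  simp only [partEnt]
  linarith

theorem partCMI_nonneg (hμ : ∀ ω, 0 ≤ μ ω) (r s t : Setoid Ω) : 0 ≤ partCMI μ r s t := by
  have h := partEnt_submodular hμ (inf_le_right : r ⊓ t ≤ t) (inf_le_right : s ⊓ t ≤ t)
  rw [← inf_inf_distrib_right] at h
  simp only [partCMI]
  linarith

/-- Partitions that agree on the support of `μ` have the same entropy. -/
theorem partEnt_congr {r s : Setoid Ω} (h : ∀ x y, μ x ≠ 0 → μ y ≠ 0 → (r x y ↔ s x y)) :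
    partEnt μ r = partEnt μ s := by
  refine sum_congr rfl fun x _ => ?_
  by_cases hx : μ x = 0
  · simp [hx]
  · have : classMass μ r x = classMass μ s x := by
      refine sum_congr rfl fun y _ => ?_
      by_cases hy : μ y = 0
      · simp [hy]
      · simp only [h x y hx hy]
    rw [this]

theorem sum_mul_comp_of_map {Ω' : Type*} [Fintype Ω'] {ν : Ω' → ℝ} {f : Ω' → Ω}
    (hf : ∀ ω, ∑ x, (if f x = ω then ν x else 0) = μ ω) (g : Ω → ℝ) :
    ∑ x, ν x * g (f x) = ∑ ω, μ ω * g ω := by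
  simp only [← hf, sum_mul]
  rw [sum_comm]
  simp

theorem classMass_comap {Ω' : Type*} [Fintype Ω'] {ν : Ω' → ℝ} {f : Ω' → Ω}
    (hf : ∀ ω, ∑ x, (if f x = ω then ν x else 0) = μ ω) (r : Setoid Ω) (x : Ω') :
    classMass ν (Setoid.comap f r) x = classMass μ r (f x) := by
  have h := sum_mul_comp_of_map hf fun ω => if r (f x) ω then 1 else 0
  simpa [classMass, Setoid.comap_rel] using h

theorem partEnt_comap {Ω' : Type*} [Fintype Ω'] {ν : Ω' → ℝ} {f : Ω' → Ω}
    (hf : ∀ ω, ∑ x, (if f x = ω then ν x else 0) = μ ω) (r : Setoid Ω) :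
    partEnt ν (Setoid.comap f r) = partEnt μ r := by
  simp only [partEnt, classMass_comap hf]
  exact sum_mul_comp_of_map hf fun ω => -Real.log (classMass μ r ω)

/-- Two copies of `(Ω, μ)` glued along `t` and conditionally independent given `t`. -/
noncomputable def glue (μ : Ω → ℝ) (t : Setoid Ω) (x : Ω × Ω) : ℝ :=
  if t x.1 x.2 then μ x.1 * μ x.2 / classMass μ t x.1 else 0

theorem glue_nonneg (hμ : ∀ ω, 0 ≤ μ ω) (t : Setoid Ω) (x : Ω × Ω) : 0 ≤ glue μ t x := by
  rw [glue]
  split_ifs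
  · exact div_nonneg (mul_nonneg (hμ _) (hμ _)) (classMass_nonneg hμ _ _)
  · exact le_rfl

theorem glue_swap (μ : Ω → ℝ) (t : Setoid Ω) (x y : Ω) : glue μ t (x, y) = glue μ t (y, x) := by
  by_cases h : t x y
  · simp only [glue, h, t.symm' h, if_true, classMass_congr μ h, mul_comm]
  · have : ¬ t y x := fun h' => h (t.symm' h')
    simp [glue, h, this]

theorem sum_glue (hμ : ∀ ω, 0 ≤ μ ω) (t : Setoid Ω) (ω : Ω) : ∑ y, glue μ t (ω, y) = μ ω := by
  have h : ∑ y, glue μ t (ω, y) = μ ω / classMass μ t ω * classMass μ t ω := by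
    conv_rhs => enter [2]; rw [classMass]
    rw [mul_sum]
    refine sum_congr rfl fun y _ => ?_
    simp only [glue]
    split_ifs
    · ring
    · simp
  rw [h]
  rcases (hμ ω).eq_or_lt with h0 | hpos
  · simp [← h0]
  · exact div_mul_cancel₀ _ (hpos.trans_le (le_classMass hμ t ω)).ne'

theorem glue_map_fst (hμ : ∀ ω, 0 ≤ μ ω) (t : Setoid Ω) (ω : Ω) :
    ∑ x : Ω × Ω, (if x.1 = ω then glue μ t x else 0) = μ ω := by
  rw [Fintype.sum_prod_type, sum_comm]
  simpa using sum_glue hμ t ω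

theorem glue_map_snd (hμ : ∀ ω, 0 ≤ μ ω) (t : Setoid Ω) (ω : Ω) :
    ∑ x : Ω × Ω, (if x.2 = ω then glue μ t x else 0) = μ ω := by
  rw [Fintype.sum_prod_type]
  simpa [glue_swap μ t _ ω] using sum_glue hμ t ω

theorem rel_of_glue_ne_zero {t : Setoid Ω} {x : Ω × Ω} (h : glue μ t x ≠ 0) : t x.1 x.2 := by
  by_contra hx
  exact h (if_neg hx)

/-- The second copy of `e` is distributed jointly with the glued part as the original `e`. -/
theorem partEnt_glue_inf (hμ : ∀ ω, 0 ≤ μ ω) {t u : Setoid Ω} (hu : t ≤ u) (e : Setoid Ω) :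
    partEnt (glue μ t) (Setoid.comap Prod.fst u ⊓ Setoid.comap Prod.snd e)
      = partEnt μ (u ⊓ e) := by
  rw [← partEnt_comap (glue_map_snd hμ t) (u ⊓ e)]
  refine partEnt_congr fun x y hx hy => ?_
  have hx' : u x.1 x.2 := hu (rel_of_glue_ne_zero hx)
  have hy' : u y.1 y.2 := hu (rel_of_glue_ne_zero hy)
  refine and_congr_left fun _ => ⟨fun h => ?_, fun h => ?_⟩
  · exact u.trans' (u.symm' hx') (u.trans' h hy')
  · exact u.trans' hx' (u.trans' h (u.symm' hy'))

theorem classMass_glue (μ : Ω → ℝ) {r t : Setoid Ω} (hr : r ≤ t) (e : Setoid Ω) {x : Ω × Ω}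
    (hx : t x.1 x.2) :
    classMass (glue μ t) (Setoid.comap Prod.fst r ⊓ Setoid.comap Prod.snd e) x
      = classMass μ r x.1 * classMass μ (t ⊓ e) x.2 / classMass μ t x.1 := by
  conv_rhs => enter [1]; rw [classMass, classMass]
  rw [classMass, Fintype.sum_prod_type, sum_mul_sum, sum_div]
  refine sum_congr rfl fun y _ => ?_
  rw [sum_div]
  refine sum_congr rfl fun z _ => ?_
  by_cases hy : r x.1 y
  · have hty : t x.1 y := hr hy
    have hiff : t y z ↔ t x.2 z :=
      ⟨fun h => t.trans' (t.symm' hx) (t.trans' hty h),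
        fun h => t.trans' (t.symm' hty) (t.trans' hx h)⟩
    have hinf : (t ⊓ e) x.2 z ↔ t x.2 z ∧ e x.2 z := Iff.rfl
    by_cases hz : e x.2 z <;> by_cases htz : t x.2 z <;>
      simp [glue, Setoid.inf_def, Setoid.comap_rel, hy, hz, htz, hiff, hinf, classMass_congr μ hty]
  · simp [Setoid.inf_def, Setoid.comap_rel, hy]

theorem partEnt_glue_condIndep (hμ : ∀ ω, 0 ≤ μ ω) {r t : Setoid Ω} (hr : r ≤ t)
    (e : Setoid Ω) :
    partEnt (glue μ t) (Setoid.comap Prod.fst r ⊓ Setoid.comap Prod.snd e)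
      = partEnt μ r + partEnt μ (t ⊓ e) - partEnt μ t := by
  rw [← partEnt_comap (glue_map_fst hμ t) r, ← partEnt_comap (glue_map_snd hμ t) (t ⊓ e),
    ← partEnt_comap (glue_map_fst hμ t) t]
  simp only [partEnt, ← sum_add_distrib, ← sum_sub_distrib]
  refine sum_congr rfl fun x _ => ?_
  rw [classMass_comap (glue_map_fst hμ t), classMass_comap (glue_map_snd hμ t),
    classMass_comap (glue_map_fst hμ t)]
  by_cases h0 : glue μ t x = 0
  · simp [h0]
  · have hx := rel_of_glue_ne_zero h0
    have hne : μ x.1 ≠ 0 ∧ μ x.2 ≠ 0 := by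
      constructor <;> intro h <;> exact h0 (by simp [glue, h])
    have pos1 : ∀ q : Setoid Ω, classMass μ q x.1 ≠ 0 := fun q =>
      (((hμ x.1).lt_of_ne' hne.1).trans_le (le_classMass hμ q x.1)).ne'
    have pos2 : ∀ q : Setoid Ω, classMass μ q x.2 ≠ 0 := fun q =>
      (((hμ x.2).lt_of_ne' hne.2).trans_le (le_classMass hμ q x.2)).ne'
    rw [classMass_glue μ hr e hx, Real.log_div (mul_ne_zero (pos1 _) (pos2 _)) (pos1 _),
      Real.log_mul (pos1 _) (pos2 _)]
    ring

/-- The Ingleton expression of four partitions. -/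
noncomputable def partIng (μ : Ω → ℝ) (a b c d : Setoid Ω) : ℝ :=
  partCMI μ a b c + partCMI μ a b d + partMI μ c d - partMI μ a b

/-- The defect `I(b : e | a) + I(a : b | e)`, which is symmetric in `a` and `e`. -/
noncomputable def partDefect (μ : Ω → ℝ) (a b e : Setoid Ω) : ℝ :=
  partCMI μ b e a + partCMI μ a b e

theorem partDefect_comm (μ : Ω → ℝ) (a b e : Setoid Ω) :
    partDefect μ a b e = partDefect μ e b a := by
  simp only [partDefect, partCMI, inf_comm, inf_left_comm]
  ring

theorem partCMI_le_ingleton_of_condIndep (hμ : ∀ ω, 0 ≤ μ ω) {a b c d e : Setoid Ω}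
    (h : partCMI μ e (c ⊓ d) (a ⊓ b) = 0) :
    partCMI μ d e b ≤ partIng μ a b c d + partDefect μ a b e + partCMI μ a e b := by
  have h1 := partCMI_nonneg hμ a b (d ⊓ e)
  have h2 := partCMI_nonneg hμ d e a
  have h3 := partCMI_nonneg hμ b e (a ⊓ c ⊓ d)
  have h4 := partCMI_nonneg hμ d e (a ⊓ b ⊓ c)
  have h5 := partCMI_nonneg hμ a b (c ⊓ e)
  have h6 := partCMI_nonneg hμ c e a
  have h7 := partCMI_nonneg hμ c e (a ⊓ b ⊓ d)
  have h8 := partCMI_nonneg hμ c e b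
  have h9 := partCMI_nonneg hμ c d e
  have h10 := partCMI_nonneg hμ a e (c ⊓ d)
  simp only [partIng, partDefect, partMI, partCMI, inf_comm, inf_left_comm] at *
  linarith

/-- The same bound with the roles of `a` and `d` exchanged in all terms but the Ingleton one. -/
theorem partCMI_le_ingleton_of_condIndep_symm (hμ : ∀ ω, 0 ≤ μ ω) {a b c d e : Setoid Ω}
    (h : partCMI μ e (a ⊓ c) (b ⊓ d) = 0) :
    partCMI μ a e b ≤ partIng μ a b c d + partDefect μ d b e + partCMI μ d e b := by
  have h1 := partCMI_nonneg hμ c e (a ⊓ b ⊓ d)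
  have h2 := partCMI_nonneg hμ b e (a ⊓ c ⊓ d)
  have h3 := partCMI_nonneg hμ b d (a ⊓ e)
  have h4 := partCMI_nonneg hμ d e (a ⊓ b ⊓ c)
  have h5 := partCMI_nonneg hμ c d e
  have h6 := partCMI_nonneg hμ a e (c ⊓ d)
  have h7 := partCMI_nonneg hμ c e a
  have h8 := partCMI_nonneg hμ a b (c ⊓ e)
  have h9 := partCMI_nonneg hμ c e b
  have h10 := partCMI_nonneg hμ a e d
  simp only [partIng, partDefect, partMI, partCMI, inf_comm, inf_left_comm] at *
  linarith

theorem partDefect_triangle (hμ : ∀ ω, 0 ≤ μ ω) {a b c d e : Setoid Ω}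
    (h : partCMI μ e (c ⊓ d) (a ⊓ b) = 0) :
    partDefect μ d b e ≤ partDefect μ a b e + partDefect μ a b d := by
  have h1 := partCMI_nonneg hμ a b (d ⊓ e)
  have h2 := partCMI_nonneg hμ d e a
  have h3 := partCMI_nonneg hμ c e (a ⊓ b ⊓ d)
  simp only [partDefect, partCMI, inf_comm, inf_left_comm] at *
  linarith

theorem partEnt_glue_fst (hμ : ∀ ω, 0 ≤ μ ω) (t r : Setoid Ω) :
    partEnt (glue μ t) (Setoid.comap Prod.fst r) = partEnt μ r :=
  partEnt_comap (glue_map_fst hμ t) r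

theorem partIng_glue_fst (hμ : ∀ ω, 0 ≤ μ ω) (t a b c d : Setoid Ω) :
    partIng (glue μ t) (Setoid.comap Prod.fst a) (Setoid.comap Prod.fst b)
      (Setoid.comap Prod.fst c) (Setoid.comap Prod.fst d) = partIng μ a b c d := by
  simp only [partIng, partMI, partCMI, ← comap_inf, partEnt_glue_fst hμ]

theorem partDefect_glue_fst (hμ : ∀ ω, 0 ≤ μ ω) (t a b c : Setoid Ω) :
    partDefect (glue μ t) (Setoid.comap Prod.fst a) (Setoid.comap Prod.fst b)
      (Setoid.comap Prod.fst c) = partDefect μ a b c := by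
  simp only [partDefect, partCMI, ← comap_inf, partEnt_glue_fst hμ]

theorem partEnt_glue_snd (hμ : ∀ ω, 0 ≤ μ ω) (t e : Setoid Ω) :
    partEnt (glue μ t) (Setoid.comap Prod.snd e) = partEnt μ e :=
  partEnt_comap (glue_map_snd hμ t) e

theorem partDefect_glue (hμ : ∀ ω, 0 ≤ μ ω) (a b e : Setoid Ω) :
    partDefect (glue μ (a ⊓ b)) (Setoid.comap Prod.fst a) (Setoid.comap Prod.fst b)
      (Setoid.comap Prod.snd e) = partDefect μ a b e := by
  have ha := partEnt_glue_inf hμ (inf_le_left : a ⊓ b ≤ a) e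
  have hb := partEnt_glue_inf hμ (inf_le_right : a ⊓ b ≤ b) e
  have hab := partEnt_glue_inf hμ (le_refl (a ⊓ b)) e
  have fa := partEnt_glue_fst hμ (a ⊓ b) a
  have fab := partEnt_glue_fst hμ (a ⊓ b) (a ⊓ b)
  have se := partEnt_glue_snd hμ (a ⊓ b) e
  simp only [comap_inf] at hab fab
  generalize glue μ (a ⊓ b) = ν at *
  generalize Setoid.comap Prod.fst a = a', Setoid.comap Prod.fst b = b',
    Setoid.comap Prod.snd e = e' at *
  simp only [partDefect, partCMI, inf_comm, inf_left_comm] at *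
  linarith

theorem partCMI_glue (hμ : ∀ ω, 0 ≤ μ ω) (a b e : Setoid Ω) :
    partCMI (glue μ (a ⊓ b)) (Setoid.comap Prod.fst a) (Setoid.comap Prod.snd e)
      (Setoid.comap Prod.fst b) = partCMI μ a e b := by
  have hb := partEnt_glue_inf hμ (inf_le_right : a ⊓ b ≤ b) e
  have hab := partEnt_glue_inf hμ (le_refl (a ⊓ b)) e
  have fb := partEnt_glue_fst hμ (a ⊓ b) b
  have fab := partEnt_glue_fst hμ (a ⊓ b) (a ⊓ b)
  simp only [comap_inf] at hab fab
  generalize glue μ (a ⊓ b) = ν at *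
  generalize Setoid.comap Prod.fst a = a', Setoid.comap Prod.fst b = b',
    Setoid.comap Prod.snd e = e' at *
  simp only [partCMI, inf_comm, inf_left_comm] at *
  linarith

theorem partCMI_glue_eq_zero (hμ : ∀ ω, 0 ≤ μ ω) (t r e : Setoid Ω) :
    partCMI (glue μ t) (Setoid.comap Prod.snd e) (Setoid.comap Prod.fst r)
      (Setoid.comap Prod.fst t) = 0 := by
  have ht := partEnt_glue_inf hμ (le_refl t) e
  have hrt := partEnt_glue_condIndep hμ (inf_le_right : r ⊓ t ≤ t) e
  have ft := partEnt_glue_fst hμ t t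
  have frt := partEnt_glue_fst hμ t (r ⊓ t)
  simp only [comap_inf] at hrt frt
  generalize glue μ t = ν at *
  generalize Setoid.comap Prod.fst r = r', Setoid.comap Prod.fst t = t',
    Setoid.comap Prod.snd e = e' at *
  simp only [partCMI, inf_comm, inf_left_comm] at *
  linarith

end Partition

/-- Five-variable form of the inequality. The two bounds, which differ by exchanging `a` and `d`
outside the Ingleton term, are proved together: each step replaces `e` by a conditionally
independent copy over `a ⊓ b` or over `d ⊓ b` and passes from one bound to the other. -/
theorem ingleton_family_nonneg (s : ℕ) {Ω : Type*} [Fintype Ω] {μ : Ω → ℝ}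
    (hμ : ∀ ω, 0 ≤ μ ω) (a b c d e : Setoid Ω) :
    0 ≤ s * (partIng μ a b c d + partDefect μ a b e) + partCMI μ a e b
        + (s * (s - 1) / 2) * partDefect μ a b d ∧
    0 ≤ s * (partIng μ a b c d + partDefect μ d b e) + partCMI μ d e b
        + (s * (s - 1) / 2) * partDefect μ a b d := by
  induction s generalizing Ω with
  | zero => simp [partCMI_nonneg hμ]
  | succ s ih =>
    have hs : (0 : ℝ) ≤ s := s.cast_nonneg
    push_cast
    constructor
    · have hν := glue_nonneg hμ (a ⊓ b)
      have hind := partCMI_glue_eq_zero hμ (a ⊓ b) (c ⊓ d) e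
      rw [comap_inf, comap_inf] at hind
      have hstep := partCMI_le_ingleton_of_condIndep hν hind
      have htri := mul_le_mul_of_nonneg_left (partDefect_triangle hν hind) hs
      have hprev := (ih hν (Setoid.comap Prod.fst a) (Setoid.comap Prod.fst b)
        (Setoid.comap Prod.fst c) (Setoid.comap Prod.fst d) (Setoid.comap Prod.snd e)).2
      rw [← partIng_glue_fst hμ (a ⊓ b), ← partDefect_glue hμ, ← partCMI_glue hμ,
        ← partDefect_glue_fst hμ (a ⊓ b) a b d]
      nlinarith
    · have hν := glue_nonneg hμ (d ⊓ b)
      have hind := partCMI_glue_eq_zero hμ (d ⊓ b) (c ⊓ a) e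
      rw [comap_inf, comap_inf] at hind
      have hstep := partCMI_le_ingleton_of_condIndep_symm hν
        (by rwa [inf_comm (Setoid.comap Prod.fst c), inf_comm (Setoid.comap Prod.fst d)] at hind)
      have htri := mul_le_mul_of_nonneg_left (partDefect_triangle hν hind) hs
      rw [partDefect_comm _ _ _ (Setoid.comap Prod.fst a)] at htri
      have hprev := (ih hν (Setoid.comap Prod.fst a) (Setoid.comap Prod.fst b)
        (Setoid.comap Prod.fst c) (Setoid.comap Prod.fst d) (Setoid.comap Prod.snd e)).1
      rw [← partIng_glue_fst hμ (d ⊓ b), ← partDefect_glue hμ, ← partCMI_glue hμ,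
        ← partDefect_glue_fst hμ (d ⊓ b) a b d]
      nlinarith

/-- **Second Matúš family of non-Shannon inequalities.** For any four random variables
`X1, X2, X3, X4` on a common finite probability space and every integer `s ≥ 1`,
`s·[I(X1:X2|X3) + I(X1:X2|X4) + I(X3:X4) − I(X1:X2)] + s·[I(X2:X3|X1) + I(X1:X2|X3)]
  + I(X1:X3|X2) + (s(s−1)/2)·[I(X2:X4|X1) + I(X1:X2|X4)] ≥ 0`. -/
theorem matus_family_two {Ω β₁ β₂ β₃ β₄ : Type*} [Fintype Ω]
    [Fintype β₁] [Fintype β₂] [Fintype β₃] [Fintype β₄]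
    (μ : Ω → ℝ) (hμ0 : ∀ ω, 0 ≤ μ ω) (hμ1 : ∑ ω, μ ω = 1)
    (X1 : Ω → β₁) (X2 : Ω → β₂) (X3 : Ω → β₃) (X4 : Ω → β₄)
    (s : ℕ) (hs : 1 ≤ s) :
    0 ≤ (s : ℝ) * (cmi μ X1 X2 X3 + cmi μ X1 X2 X4 + mi μ X3 X4 - mi μ X1 X2)
      + (s : ℝ) * (cmi μ X2 X3 X1 + cmi μ X1 X2 X3)
      + cmi μ X1 X3 X2
      + ((s : ℝ) * ((s : ℝ) - 1) / 2) * (cmi μ X2 X4 X1 + cmi μ X1 X2 X4) := by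
  have h := (ingleton_family_nonneg s hμ0 (Setoid.ker X1) (Setoid.ker X2) (Setoid.ker X3)
    (Setoid.ker X4) (Setoid.ker X3)).1
  simp only [partIng, partDefect, ← cmi_eq_partCMI, ← mi_eq_partMI] at h
  linarith
end
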